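/- arXiv:1912.12648 — 2 statements merged into one kernel-verified Lean document; each statement's English description precedes it below -/
import Mathlib

section
/- Suppose p = 2. Let a ∈ GF(Q) with G(a) ≠ 0, set E = a·F(a)^{q+1}/G(a)^2 and H = Tr_{GF(2^d)/GF(2)}( N_{GF(Q)/GF(2^d)}(a) / G(a)^2 ). Then T_k(E) := E + E^{2^1} + ... + E^{2^{k-1}} equals ( G(a) + F(a)^q ) / G(a) + (k/d)·H (the last term computed modulo 2). -/
open Polynomial

noncomputable abbrev Kbar (p : ℕ) [Fact p.Prime] : Type := AlgebraicClosure (ZMod p)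

noncomputable def A (q : ℕ) (K : Type) [Field K] : ℕ → Polynomial K
  | 0 => 0
  | 1 => 1
  | 2 => -1
  | (r+3) => -(A q K (r+2))^q - X^q * (A q K (r+1))^(q^2)


/-- The left recursion defining `A`, evaluated at a point in characteristic two. -/
theorem eval_A_add_two {K : Type} [Field K] [CharP K 2] (q : ℕ) (hq : q ≠ 0) (a : K) (r : ℕ) :
    (A q K (r + 2)).eval a =
      ((A q K (r + 1)).eval a) ^ q + a ^ q * (((A q K r).eval a) ^ q) ^ q := by
  cases r with
  | zero => simp [A, CharTwo.neg_eq, hq]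
  | succ r => simp [A, CharTwo.neg_eq, CharTwo.sub_eq_add, ← pow_mul, sq]

/-- Expanding the continuant `A` at its other end. -/
theorem eval_A_add_two_right {K : Type} [Field K] [CharP K 2] (k : ℕ) (a : K) (r : ℕ) :
    (A (2 ^ k) K (r + 2)).eval a =
      (A (2 ^ k) K (r + 1)).eval a + a ^ (2 ^ k) ^ r * (A (2 ^ k) K r).eval a := by
  have hq : (2 ^ k : ℕ) ≠ 0 := by positivity
  induction r using Nat.twoStepInduction with
  | zero => simp [A, CharTwo.neg_eq]
  | one => simp [A, CharTwo.neg_eq, CharTwo.sub_eq_add]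
  | more r ih₀ ih₁ =>
    have e₂ := eval_A_add_two (2 ^ k) hq a (r + 2)
    have e₁ := eval_A_add_two (2 ^ k) hq a (r + 1)
    have e₀ := eval_A_add_two (2 ^ k) hq a r
    have i₁ := congrArg (· ^ 2 ^ k) ih₁
    have i₀ := congrArg (fun x => (x ^ 2 ^ k) ^ 2 ^ k) ih₀
    simp only [add_pow_char_pow, mul_pow, pow_succ (2 ^ k), pow_mul a] at i₁ i₀ ⊢
    linear_combination e₂ + i₁ + a ^ 2 ^ k * i₀ - e₁ -
      ((a ^ (2 ^ k) ^ r) ^ 2 ^ k) ^ 2 ^ k * e₀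

/-- The determinant identity for continuants. -/
theorem eval_A_det {K : Type} [Field K] [CharP K 2] (k : ℕ) (a : K) (r : ℕ) :
    (A (2 ^ k) K (r + 2)).eval a * ((A (2 ^ k) K r).eval a) ^ 2 ^ k +
      (A (2 ^ k) K (r + 1)).eval a * ((A (2 ^ k) K (r + 1)).eval a) ^ 2 ^ k =
      ∏ i ∈ Finset.range r, a ^ (2 ^ k) ^ (i + 1) := by
  induction r with
  | zero => simp [A]
  | succ r ih =>
    have h := congrArg (· ^ 2 ^ k) (eval_A_add_two_right k a r)
    beta_reduce at h
    rw [add_pow_char_pow, mul_pow, ← pow_mul a, ← pow_succ] at h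
    rw [Finset.prod_range_succ, ← ih, h, eval_A_add_two_right k a (r + 1)]
    linear_combination ((A (2 ^ k) K (r + 2)).eval a * ((A (2 ^ k) K (r + 1)).eval a) ^ 2 ^ k) *
      CharTwo.two_eq_zero (R := K)

/-- The values of `A` stay in every finite subfield containing the argument. -/
theorem eval_A_pow_card {K : Type} [Field K] [CharP K 2] (k n : ℕ) (a : K) (ha : a ^ 2 ^ n = a)
    (r : ℕ) : ((A (2 ^ k) K r).eval a) ^ 2 ^ n = (A (2 ^ k) K r).eval a := by
  induction r using Nat.twoStepInduction with
  | zero => simp [A]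
  | one => simp [A]
  | more r ih₀ ih₁ =>
    rw [eval_A_add_two_right, add_pow_char_pow, mul_pow, ih₀, ih₁, pow_right_comm, ha]

theorem pow_two_pow_gcd {K : Type} [Monoid K] (n k : ℕ) (x : K) (hn : x ^ 2 ^ n = x)
    (hk : x ^ 2 ^ k = x) : x ^ 2 ^ Nat.gcd n k = x := by
  have key (j : ℕ) : Function.IsPeriodicPt (fun y : K => y ^ 2) j x ↔ x ^ 2 ^ j = x := by
    rw [Function.IsPeriodicPt, Function.IsFixedPt, pow_iterate]
  exact (key _).1 (((key n).2 hn).gcd ((key k).2 hk))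

theorem pow_pow_mod {K : Type} [Monoid K] (b m : ℕ) (x : K) (h : x ^ b ^ m = x) (j : ℕ) :
    x ^ b ^ (j % m) = x ^ b ^ j := by
  have key (s : ℕ) : x ^ b ^ (m * s) = x := by
    induction s with
    | zero => simp
    | succ s ih => rw [Nat.mul_succ, pow_add, pow_mul, ih, h]
  conv_rhs => rw [← Nat.div_add_mod j m, pow_add, pow_mul, key]

/-- The norm to the fixed field may be computed with any generator of the Galois group. -/
theorem prod_pow_pow_eq_of_coprime {K : Type} [CommMonoid K] (b m c : ℕ) (hm : 0 < m)
    (hc : Nat.Coprime m c) (x : K) (h : x ^ b ^ m = x) :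
    ∏ i ∈ Finset.range m, x ^ (b ^ c) ^ i = ∏ i ∈ Finset.range m, x ^ b ^ i := by
  have hmaps : Set.MapsTo (fun i => c * i % m) (Finset.range m) (Finset.range m) := by
    intro i _
    simpa using Nat.mod_lt _ hm
  have hinj : Set.InjOn (fun i => c * i % m) (Finset.range m) := by
    intro i hi j hj hij
    have h' : i ≡ j [MOD m] := Nat.ModEq.cancel_left_of_coprime hc hij
    exact Nat.ModEq.eq_of_lt_of_lt h' (by simpa using hi) (by simpa using hj)
  refine Finset.prod_bij (fun i _ => c * i % m) (fun i hi => hmaps hi)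
    (fun i hi j hj hij => hinj hi hj hij) ?_ ?_
  · intro j hj
    obtain ⟨i, hi, hij⟩ := Finset.surjOn_of_injOn_of_card_le _ hmaps hinj le_rfl hj
    exact ⟨i, hi, hij⟩
  · intro i _
    rw [pow_pow_mod b m x h, pow_mul]

theorem prod_pow_pow_fixed {K : Type} [CommMonoid K] (b m : ℕ) (x : K) (h : x ^ b ^ m = x) :
    (∏ i ∈ Finset.range m, x ^ b ^ i) ^ b = ∏ i ∈ Finset.range m, x ^ b ^ i := by
  cases m with
  | zero => simp
  | succ m =>
    rw [← Finset.prod_pow, Finset.prod_range_succ, Finset.prod_range_succ', pow_zero, pow_one,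
      ← pow_mul, ← pow_succ, h]
    simp only [← pow_mul, ← pow_succ]

/-- The sum over `d * j` Frobenius powers of an element of `GF(2 ^ d)` is `j` times its trace. -/
theorem sum_pow_two_pow_mul {K : Type} [Semiring K] (d j : ℕ) (w : K) (h : w ^ 2 ^ d = w) :
    ∑ i ∈ Finset.range (d * j), w ^ 2 ^ i = (j : K) * ∑ i ∈ Finset.range d, w ^ 2 ^ i := by
  have key (s : ℕ) : w ^ 2 ^ (d * s) = w := by
    induction s with
    | zero => simp
    | succ s ih => rw [Nat.mul_succ, pow_add, pow_mul, ih, h]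
  induction j with
  | zero => simp
  | succ j ih =>
    rw [Nat.mul_succ, Finset.sum_range_add, ih]
    simp only [pow_add 2 (d * j), pow_mul w, key]
    simp [add_mul]

theorem sum_add_sq_pow_two_pow {K : Type} [Field K] [CharP K 2] (k : ℕ) (z : K) :
    ∑ i ∈ Finset.range k, (z ^ 2 + z) ^ 2 ^ i = z ^ 2 ^ k + z := by
  induction k with
  | zero => simp [CharTwo.add_self_eq_zero]
  | succ k ih =>
    rw [Finset.sum_range_succ, ih, add_pow_char_pow, ← pow_mul, ← pow_succ']
    linear_combination z ^ 2 ^ k * CharTwo.two_eq_zero (R := K)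

/-- `p = 2`. For `a ∈ GF(Q)` with `G(a) ≠ 0`, setting `E = a·F(a)^{q+1}/G(a)²` and
`H = Tr_{GF(2^d)/GF(2)}(N_{GF(Q)/GF(2^d)}(a)/G(a)²)`, one has
`T_k(E) = E + E² + ⋯ + E^{2^{k-1}} = (G(a) + F(a)^q)/G(a) + (k/d)·H` (the last term mod 2). -/
theorem statement_11 (k n d m q Q : ℕ) (hk : 0 < k) (hn : 0 < n)
    (hd : d = Nat.gcd n k) (hm : m = n / d) (hq : q = 2 ^ k) (hQ : Q = 2 ^ n)
    (a : Kbar 2) (haQ : a ^ Q = a)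
    (Fa Ga Nr E H : Kbar 2)
    (hFa : Fa = (A q (Kbar 2) m).eval a)
    (hGa : Ga = -(A q (Kbar 2) (m + 1)).eval a - a * ((A q (Kbar 2) (m - 1)).eval a) ^ q)
    (hGa0 : Ga ≠ 0)
    (hNr : Nr = ∏ i ∈ Finset.range m, a ^ (2 ^ d) ^ i)
    (hE : E = a * Fa ^ (q + 1) / Ga ^ 2)
    (hH : H = ∑ i ∈ Finset.range d, (Nr / Ga ^ 2) ^ 2 ^ i) :
    ∑ i ∈ Finset.range k, E ^ 2 ^ i = (Ga + Fa ^ q) / Ga + ((k / d : ℕ) : Kbar 2) * H := by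
  have : CharP (Kbar 2) 2 := inferInstance
  have h2 : (2 : Kbar 2) = 0 := CharTwo.two_eq_zero
  subst hq hQ
  have hd0 : 0 < d := hd ▸ Nat.gcd_pos_of_pos_left _ hn
  have hdm : d * m = n := by rw [hm, hd]; exact Nat.mul_div_cancel' (Nat.gcd_dvd_left n k)
  have hdk : d * (k / d) = k := by rw [hd]; exact Nat.mul_div_cancel' (Nat.gcd_dvd_right n k)
  have hcop : Nat.Coprime m (k / d) := by
    rw [hm, hd]; exact Nat.coprime_div_gcd_div_gcd (hd ▸ hd0)
  have hm0 : 0 < m := Nat.pos_of_mul_pos_left (hdm ▸ hn)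
  have ham : a ^ (2 ^ d) ^ m = a := by rw [← pow_mul, hdm, haQ]
  have hnorm : ∏ i ∈ Finset.range m, a ^ (2 ^ k) ^ i = Nr := by
    rw [hNr, ← prod_pow_pow_eq_of_coprime (2 ^ d) m (k / d) hm0 hcop a ham, ← pow_mul 2, hdk]
  have hNfix : Nr ^ 2 ^ d = Nr := hNr ▸ prod_pow_pow_fixed (2 ^ d) m a ham
  have hakm : a ^ (2 ^ k) ^ m = a := by
    have := pow_pow_mod (2 ^ d) m a ham (k / d * m)
    rwa [Nat.mul_mod_left, pow_zero, pow_one, pow_mul, ← pow_mul 2, hdk, eq_comm] at this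
  obtain ⟨r, rfl⟩ : ∃ r, m = r + 1 := ⟨m - 1, by omega⟩
  rw [Nat.add_sub_cancel, CharTwo.neg_eq, CharTwo.sub_eq_add] at hGa
  set c := (A (2 ^ k) (Kbar 2) (r + 1 + 1)).eval a with hc
  set b := (A (2 ^ k) (Kbar 2) r).eval a with hb
  have hleft : c = Fa ^ 2 ^ k + a ^ 2 ^ k * (b ^ 2 ^ k) ^ 2 ^ k := by
    rw [hc, hFa]; exact eval_A_add_two (2 ^ k) (by positivity) a r
  have hright : c ^ 2 ^ k = Fa ^ 2 ^ k + a * b ^ 2 ^ k := by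
    rw [hc, hFa, eval_A_add_two_right, add_pow_char_pow, mul_pow, ← pow_mul, ← pow_succ, hakm]
  have hdet : c * (a * b ^ 2 ^ k) + a * (Fa * Fa ^ 2 ^ k) = Nr := by
    rw [← hnorm, Finset.prod_range_succ', ← eval_A_det k a r, ← hFa]
    simp only [pow_zero, pow_one]
    ring
  have hGk : Ga ^ 2 ^ k = Ga := by
    rw [hGa, add_pow_char_pow, hright, mul_pow]
    linear_combination -hleft
  have hGn : Ga ^ 2 ^ n = Ga := by
    rw [hGa, add_pow_char_pow, mul_pow, haQ, pow_right_comm, hc, hb,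
      eval_A_pow_card k n a haQ, eval_A_pow_card k n a haQ]
  have hGd : Ga ^ 2 ^ d = Ga := hd ▸ pow_two_pow_gcd n k Ga hGn hGk
  have hw : (Nr / Ga ^ 2) ^ 2 ^ d = Nr / Ga ^ 2 := by
    rw [div_pow, hNfix, pow_right_comm, hGd]
  have hEz : E = ((c / Ga) ^ 2 + c / Ga) + Nr / Ga ^ 2 := by
    rw [hE]
    field_simp
    rw [← hdet, pow_succ]
    linear_combination (-c) * hGa + (-c ^ 2 - c * (a * b ^ 2 ^ k)) * h2
  have hsum : ∑ i ∈ Finset.range k, (Nr / Ga ^ 2) ^ 2 ^ i = ((k / d : ℕ) : Kbar 2) * H := by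
    rw [hH, ← sum_pow_two_pow_mul d (k / d) _ hw, hdk]
  simp only [hEz, add_pow_char_pow _ (Nr / Ga ^ 2)]
  rw [Finset.sum_add_distrib, sum_add_sq_pow_two_pow, hsum, div_pow, hGk, ← add_div, hright]
  congr 2
  linear_combination -hGa
end

section
/- Suppose p is odd. Let a ∈ GF(Q) be nonzero and set E = G(a)^2 - 4·a·F(a)^{q+1} (an element of GF(p^d)). Then P_a(X) = X^{q+1} + X + a has no zeros in GF(Q) if and only if E is not a square in GF(p^d), i.e., E^{(p^d - 1)/2} ∉ {0, 1}. -/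
open Polynomial

section TwistedRecurrence

variable {K : Type*} [Field K]

/-- The sequence `0, 1, -1, …` with `e (r + 2) = -φ (e (r + 1)) - φ a * φ (φ (e r))`. For `φ` the
`q`-power Frobenius it gives the values of the polynomials `A_r` at `a`. -/
def twistedSeq (φ : K →+* K) (a : K) : ℕ → K
  | 0 => 0
  | 1 => 1
  | r + 2 => -φ (twistedSeq φ a (r + 1)) - φ a * φ (φ (twistedSeq φ a r))

variable {φ : K →+* K} {a x : K}

theorem twistedSeq_add_two (φ : K →+* K) (a : K) (r : ℕ) : twistedSeq φ a (r + 2) =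
    -φ (twistedSeq φ a (r + 1)) - φ a * φ (φ (twistedSeq φ a r)) := by
  rw [twistedSeq]

theorem twistedSeq_add_two_eq_iterate (φ : K →+* K) (a : K) (r : ℕ) : twistedSeq φ a (r + 2) =
    -twistedSeq φ a (r + 1) - φ^[r] a * twistedSeq φ a r := by
  induction r using Nat.twoStepInduction with
  | zero => simp [twistedSeq]
  | one => simp [twistedSeq]
  | more r h₀ h₁ =>
    have h₂ := congrArg φ h₁
    have h₃ := congrArg (fun z ↦ φ (φ z)) h₀
    simp only [map_sub, map_neg, map_mul, ← Function.iterate_succ_apply' φ] at h₂ h₃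
    simp only [Function.iterate_succ_apply'] at h₂ h₃ ⊢
    have s₂ := twistedSeq_add_two φ a (r + 2)
    have s₁ := twistedSeq_add_two φ a (r + 1)
    have s₀ := twistedSeq_add_two φ a r
    simp only [add_assoc, Nat.reduceAdd] at *
    linear_combination s₂ - h₂ - φ a * h₃ + s₁ + φ (φ (φ^[r] a)) * s₀

theorem map_twistedSeq {ψ : K →+* K} (hψ : ∀ z, ψ (φ z) = φ (ψ z)) (ha : ψ a = a) (r : ℕ) :
    ψ (twistedSeq φ a r) = twistedSeq φ a r := by
  induction r using Nat.twoStepInduction with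
  | zero => simp [twistedSeq]
  | one => simp [twistedSeq]
  | more r h₀ h₁ => simp [twistedSeq_add_two, hψ, h₀, h₁, ha]

/-- `twistedSeq` depends only on the action of `φ` on a `φ`-stable fixed field containing `a`. -/
theorem twistedSeq_congr {φ' ψ : K →+* K} (hψ : ∀ z, ψ (φ z) = φ (ψ z)) (ha : ψ a = a)
    (h : ∀ z, ψ z = z → φ' z = φ z) (r : ℕ) : twistedSeq φ' a r = twistedSeq φ a r := by
  induction r using Nat.twoStepInduction with
  | zero => rfl
  | one => rfl
  | more r h₀ h₁ =>
    have hr := map_twistedSeq hψ ha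
    rw [twistedSeq_add_two, twistedSeq_add_two, h₀, h₁, h _ (hr _), h _ ha, h _ (hr _),
      h _ (by rw [hψ, hr])]

/-- At a zero of `X φ(X) + X + a` the expressions `e (r + 1) x - a φ (e r)` are twisted powers
of `x`. -/
theorem twistedSeq_mul_sub_succ (hx : x * φ x + x + a = 0) (r : ℕ) :
    twistedSeq φ a (r + 2) * x - a * φ (twistedSeq φ a (r + 1)) =
      x * φ (twistedSeq φ a (r + 1) * x - a * φ (twistedSeq φ a r)) := by
  rw [twistedSeq_add_two]
  simp only [map_sub, map_mul]
  linear_combination -φ (twistedSeq φ a (r + 1)) * hx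

theorem twistedSeq_mul_sub_succ_eq_iterate (hx : x * φ x + x + a = 0) (r : ℕ) :
    twistedSeq φ a (r + 2) * x - a * φ (twistedSeq φ a (r + 1)) =
      (twistedSeq φ a (r + 1) * x - a * φ (twistedSeq φ a r)) * φ^[r + 1] x := by
  induction r with
  | zero =>
    simp [twistedSeq]
    linear_combination -hx
  | succ r ih =>
    rw [twistedSeq_mul_sub_succ hx, ih, map_mul, Function.iterate_succ_apply' φ (r + 1), ← mul_assoc,
      ← twistedSeq_mul_sub_succ hx, ih]

theorem twistedSeq_mul_sub_ne_zero (hx : x * φ x + x + a = 0) (hx0 : x ≠ 0) (r : ℕ) :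
    twistedSeq φ a (r + 1) * x - a * φ (twistedSeq φ a r) ≠ 0 := by
  induction r with
  | zero => simpa [twistedSeq] using hx0
  | succ r ih =>
    rw [twistedSeq_mul_sub_succ hx]
    exact mul_ne_zero hx0 ((map_ne_zero φ).2 ih)

theorem map_twistedSeq_trace {r : ℕ} (ha : φ^[r + 1] a = a) :
    φ (twistedSeq φ a (r + 2) - a * φ (twistedSeq φ a r)) =
      twistedSeq φ a (r + 2) - a * φ (twistedSeq φ a r) := by
  have h := congrArg φ (twistedSeq_add_two_eq_iterate φ a r)
  simp only [map_sub, map_neg, map_mul, ← Function.iterate_succ_apply' φ, ha] at h ⊢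
  linear_combination h - twistedSeq_add_two φ a r

/-- A zero of `X φ(X) + X + a` fixed by `φ^[r + 1]` provides a `φ`-invariant square root of the
discriminant. -/
theorem map_eq_self_and_sq_eq_of_root {r : ℕ} (ha : φ^[r + 1] a = a) (ha0 : a ≠ 0)
    (hx : x * φ x + x + a = 0) (hxr : φ^[r + 1] x = x) :
    φ (2 * twistedSeq φ a (r + 1) * x + (-twistedSeq φ a (r + 2) - a * φ (twistedSeq φ a r))) =
      2 * twistedSeq φ a (r + 1) * x + (-twistedSeq φ a (r + 2) - a * φ (twistedSeq φ a r)) ∧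
    (2 * twistedSeq φ a (r + 1) * x + (-twistedSeq φ a (r + 2) - a * φ (twistedSeq φ a r))) ^ 2 =
      (-twistedSeq φ a (r + 2) - a * φ (twistedSeq φ a r)) ^ 2 -
        4 * a * (twistedSeq φ a (r + 1) * φ (twistedSeq φ a (r + 1))) := by
  have hx0 : x ≠ 0 := by
    rintro rfl
    simp at hx
    exact ha0 hx
  have h₁ := twistedSeq_mul_sub_succ hx r
  have h₂ := twistedSeq_mul_sub_succ_eq_iterate hx r
  rw [hxr] at h₂
  have hl : φ (twistedSeq φ a (r + 1) * x - a * φ (twistedSeq φ a r)) =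
      twistedSeq φ a (r + 1) * x - a * φ (twistedSeq φ a r) :=
    mul_left_cancel₀ hx0 (by rw [← h₁, h₂, mul_comm])
  have ht := map_twistedSeq_trace ha
  constructor
  · simp only [map_sub, map_neg, map_mul, map_add, map_ofNat] at hl ht ⊢
    linear_combination 2 * hl - ht
  · linear_combination -4 * twistedSeq φ a (r + 1) * h₂

/-- Conversely a `φ`-invariant square root `y` of the discriminant yields a zero of
`X φ(X) + X + a`, provided that `e (r + 1) ≠ 0`. -/
theorem root_of_map_eq_self_sq_eq {r : ℕ} {y : K} (ha : φ^[r + 1] a = a) (h2 : (2 : K) ≠ 0)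
    (hF : twistedSeq φ a (r + 1) ≠ 0) (hy : φ y = y)
    (hyE : y ^ 2 = (-twistedSeq φ a (r + 2) - a * φ (twistedSeq φ a r)) ^ 2 -
      4 * a * (twistedSeq φ a (r + 1) * φ (twistedSeq φ a (r + 1))))
    (hx : 2 * twistedSeq φ a (r + 1) * x =
      y - (-twistedSeq φ a (r + 2) - a * φ (twistedSeq φ a r))) :
    x * φ x + x + a = 0 := by
  have ht := map_twistedSeq_trace ha
  have hs := twistedSeq_add_two φ a r
  have hx' := congrArg φ hx
  simp only [map_sub, map_neg, map_mul, map_ofNat, hy] at hx' ht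
  have hl : φ (twistedSeq φ a (r + 1)) * φ x - φ a * φ (φ (twistedSeq φ a r)) =
      twistedSeq φ a (r + 1) * x - a * φ (twistedSeq φ a r) := by
    apply mul_left_cancel₀ h2
    linear_combination hx' - hx + ht
  have hquad : twistedSeq φ a (r + 1) * x ^ 2 +
      (-twistedSeq φ a (r + 2) - a * φ (twistedSeq φ a r)) * x +
      a * φ (twistedSeq φ a (r + 1)) = 0 := by
    apply mul_left_cancel₀ (mul_ne_zero (mul_ne_zero h2 h2) hF)
    linear_combination hyE + (2 * twistedSeq φ a (r + 1) * x + y +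
      (-twistedSeq φ a (r + 2) - a * φ (twistedSeq φ a r))) * hx
  apply mul_left_cancel₀ ((map_ne_zero φ).2 hF)
  linear_combination x * hl + hquad + x * hs

/-- If `e (r + 1) = 0` then all zeros of `X φ(X) + X + a` are fixed by `φ^[r + 1]`. -/
theorem iterate_eq_self_of_twistedSeq_eq_zero {r : ℕ} (ha : φ^[r + 1] a = a) (ha0 : a ≠ 0)
    (hF : twistedSeq φ a (r + 1) = 0) (hx : x * φ x + x + a = 0) : φ^[r + 1] x = x := by
  have hx0 : x ≠ 0 := by
    rintro rfl
    simp at hx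
    exact ha0 hx
  have h := twistedSeq_mul_sub_succ_eq_iterate hx r
  have h0 := twistedSeq_mul_sub_ne_zero hx hx0 r
  have hs' := congrArg φ (twistedSeq_add_two_eq_iterate φ a r)
  simp only [map_sub, map_neg, map_mul, ← Function.iterate_succ_apply' φ, ha] at hs'
  simp only [hF, map_zero] at h h0 hs'
  have hl : twistedSeq φ a (r + 2) = -(a * φ (twistedSeq φ a r)) := by
    have h₃ := twistedSeq_add_two φ a (r + 1)
    have h₄ := twistedSeq_add_two_eq_iterate φ a (r + 1)
    simp only [add_assoc, Nat.reduceAdd, hF, map_zero, mul_zero] at h₃ h₄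
    linear_combination h₄ - h₃ + hs'
  apply mul_left_cancel₀ h0
  linear_combination x * hl - h

end TwistedRecurrence

section Frobenius

variable {K : Type*} [Field K]

theorem card_rootSet_X_pow_succ_add_X_add_C [IsAlgClosed K] {N : ℕ} (hN : (N : K) = 0) (hN0 : N ≠ 0)
    {a : K} (ha0 : a ≠ 0) :
    Fintype.card ((X ^ (N + 1) + X + C a : K[X]).rootSet K) = N + 1 := by
  have hdeg : (X ^ (N + 1) + X + C a : K[X]).natDegree = N + 1 := by
    have : 1 < N + 1 := by lia
    compute_degree!
    simp [hN0]
  rw [card_rootSet_eq_natDegree _ (IsAlgClosed.splits _), hdeg]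
  rw [Polynomial.Separable, derivative_add, derivative_add, derivative_C, derivative_X,
    derivative_X_pow, Nat.cast_add, hN, Nat.add_sub_cancel]
  refine ⟨C a⁻¹, -(C a⁻¹ * X), ?_⟩
  have h : (C a⁻¹ * C a : K[X]) = 1 := by rw [← C_mul, inv_mul_cancel₀ ha0, C_1]
  simp only [Nat.cast_one, zero_add, C_1, one_mul, add_zero]
  linear_combination h

variable (p : ℕ) [Fact p.Prime] [CharP K p]

theorem isPeriodicPt_frobenius_iff {n : ℕ} {x : K} :
    Function.IsPeriodicPt (frobenius K p) n x ↔ x ^ p ^ n = x := by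
  rw [Function.IsPeriodicPt, Function.IsFixedPt, iterate_frobenius]

variable {p}

theorem pow_pow_gcd_eq_self {x : K} {n k : ℕ} (hn : x ^ p ^ n = x) (hk : x ^ p ^ k = x) :
    x ^ p ^ n.gcd k = x := by
  rw [← isPeriodicPt_frobenius_iff] at *
  exact hn.gcd hk

theorem pow_pow_eq_of_dvd {x : K} {n k : ℕ} (hn : x ^ p ^ n = x) (hk : n ∣ k) :
    x ^ p ^ k = x := by
  rw [← isPeriodicPt_frobenius_iff] at *
  exact hn.trans_dvd hk

theorem pow_pow_eq_of_modEq {x : K} {n i j : ℕ} (hn : x ^ p ^ n = x) (h : i ≡ j [MOD n]) :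
    x ^ p ^ i = x ^ p ^ j := by
  rw [← isPeriodicPt_frobenius_iff] at hn
  rw [← iterate_frobenius, ← iterate_frobenius, ← hn.iterate_mod_apply, h, hn.iterate_mod_apply]

theorem iterateFrobenius_iterate_apply (k r : ℕ) (x : K) :
    (iterateFrobenius K p k)^[r] x = x ^ p ^ (k * r) := by
  rw [← coe_iterateFrobenius_mul, iterateFrobenius_def]

theorem iterateFrobenius_comm_apply (i j : ℕ) (x : K) :
    iterateFrobenius K p i (iterateFrobenius K p j x) =
      iterateFrobenius K p j (iterateFrobenius K p i x) := by
  simp only [iterateFrobenius_def, ← pow_mul, mul_comm]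

theorem eval_A_eq_twistedSeq {K : Type} [Field K] [CharP K p] (k : ℕ) (a : K) (r : ℕ) :
    (A (p ^ k) K r).eval a = twistedSeq (iterateFrobenius K p k) a r := by
  have hp : p ≠ 0 := (Fact.out : p.Prime).ne_zero
  induction r using Nat.twoStepInduction with
  | zero => simp [A, twistedSeq]
  | one => simp [A, twistedSeq]
  | more r h₀ h₁ =>
    rw [twistedSeq_add_two, ← h₀, ← h₁]
    rcases r with _ | r
    · simp [A]
    · simp [A, iterateFrobenius_def, ← pow_mul, sq]

/-- When `e m = 0`, replace `k` by `d * ℓ` with `ℓ` a large prime congruent to `k / d` modulo `m`.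
This changes nothing on the field with `p ^ n` elements, and the `p ^ n`-power Frobenius acts with
order dividing `ℓ` on the `p ^ (d * ℓ) + 1` roots in `K`, so it fixes one of them. -/
theorem exists_root_of_twistedSeq_eq_zero [IsAlgClosed K] {n k r : ℕ} (hn : 0 < n)
    (hr : n / n.gcd k = r + 1) {a : K} (ha : a ^ p ^ n = a) (ha0 : a ≠ 0)
    (hF : twistedSeq (iterateFrobenius K p k) a (r + 1) = 0) :
    ∃ x : K, x ^ p ^ n = x ∧ x * iterateFrobenius K p k x + x + a = 0 := by
  have hp : p.Prime := Fact.out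
  obtain ⟨k', hk'⟩ := Nat.gcd_dvd_right n k
  have hd : 0 < n.gcd k := Nat.gcd_pos_of_pos_left k hn
  have hcop : Nat.Coprime (n / n.gcd k) (k / n.gcd k) := Nat.coprime_div_gcd_div_gcd hd
  have hn' : n = n.gcd k * (r + 1) := by rw [← hr, Nat.mul_div_cancel' (Nat.gcd_dvd_left n k)]
  have hk'' : k / n.gcd k = k' := Nat.div_eq_of_eq_mul_right hd hk'
  rw [hr, hk''] at hcop
  generalize hdd : n.gcd k = d at *
  obtain ⟨ℓ, hℓ, hℓp, hℓk⟩ := Nat.forall_exists_prime_gt_and_eq_mod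
    ((ZMod.isUnit_iff_coprime k' (r + 1)).2 hcop.symm) (p ^ d + 1)
  have : Fact ℓ.Prime := ⟨hℓp⟩
  rw [ZMod.natCast_eq_natCast_iff] at hℓk
  have hmod : d * ℓ ≡ k [MOD n] := by
    rw [hk', hn']
    exact hℓk.mul_left' d
  have hcongr : ∀ z : K, z ^ p ^ n = z →
      iterateFrobenius K p (d * ℓ) z = iterateFrobenius K p k z := fun z hz ↦ by
    rw [iterateFrobenius_def, iterateFrobenius_def, pow_pow_eq_of_modEq hz hmod]
  have hF' : twistedSeq (iterateFrobenius K p (d * ℓ)) a (r + 1) = 0 := by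
    rw [← hF]
    exact twistedSeq_congr (ψ := iterateFrobenius K p n) (iterateFrobenius_comm_apply n k) ha
      hcongr _
  have hexp : d * ℓ * (r + 1) = n * ℓ := by rw [hn']; ring
  have ha' : (iterateFrobenius K p (d * ℓ))^[r + 1] a = a := by
    rw [iterateFrobenius_iterate_apply, hexp]
    exact pow_pow_eq_of_dvd ha (dvd_mul_right _ _)
  have hcard := card_rootSet_X_pow_succ_add_X_add_C (K := K) (N := p ^ (d * ℓ))
    (by simp [hd.ne', hℓp.ne_zero]) (pow_ne_zero _ hp.ne_zero) ha0
  have hpoly : (X ^ (p ^ (d * ℓ) + 1) + X + C a : K[X]) ≠ 0 := by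
    intro h
    simp [h] at hcard
  have hmem : ∀ x : K, x ∈ (X ^ (p ^ (d * ℓ) + 1) + X + C a : K[X]).rootSet K ↔
      x * iterateFrobenius K p (d * ℓ) x + x + a = 0 := fun x ↦ by
    rw [mem_rootSet_of_ne hpoly]
    simp [iterateFrobenius_def, pow_succ']
  have han : iterateFrobenius K p n a = a := ha
  have hstab : ∀ x : K, x ∈ (X ^ (p ^ (d * ℓ) + 1) + X + C a : K[X]).rootSet K →
      iterateFrobenius K p n x ∈ (X ^ (p ^ (d * ℓ) + 1) + X + C a : K[X]).rootSet K := by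
    intro x hx
    have h := congrArg (iterateFrobenius K p n) ((hmem x).1 hx)
    rw [hmem, iterateFrobenius_comm_apply (d * ℓ) n]
    rwa [map_add, map_add, map_mul, han, map_zero] at h
  let f : Function.End ((X ^ (p ^ (d * ℓ) + 1) + X + C a : K[X]).rootSet K) :=
    fun x ↦ ⟨iterateFrobenius K p n x, hstab x x.2⟩
  have hf : ∀ i x, ((f ^ i) x : K) = (iterateFrobenius K p n)^[i] x := fun i x ↦ by
    induction i with
    | zero => rfl
    | succ i ih =>
      rw [Function.iterate_succ_apply', ← ih]
      exact congrArg Subtype.val (congrFun (pow_succ' f i) x)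
  have hfℓ : f ^ ℓ ^ 1 = 1 := by
    funext x
    apply Subtype.ext
    rw [hf, pow_one, iterateFrobenius_iterate_apply, ← hexp, ← iterateFrobenius_iterate_apply]
    exact iterate_eq_self_of_twistedSeq_eq_zero ha' ha0 hF' ((hmem x).1 x.2)
  classical
  have hmodEq := Equiv.Perm.card_fixedPoints_modEq hfℓ
  have hfermat : p ^ (d * ℓ) ≡ p ^ d [MOD ℓ] := by
    rw [← ZMod.natCast_eq_natCast_iff, pow_mul]
    simp
  have hne : Fintype.card (Function.fixedPoints f) ≠ 0 := by
    intro h0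
    rw [hcard, h0] at hmodEq
    have := (Nat.modEq_zero_iff_dvd).1 ((hfermat.add_right 1).symm.trans hmodEq)
    exact absurd (Nat.le_of_dvd (Nat.succ_pos _) this) (by lia)
  obtain ⟨⟨x, hx⟩⟩ := Fintype.card_pos_iff.1 (Nat.pos_of_ne_zero hne)
  have hxn : (x : K) ^ p ^ n = x := congrArg Subtype.val hx
  exact ⟨x, hxn, by rw [← hcongr _ hxn]; exact (hmem x).1 x.2⟩

end Frobenius

/-- `p` odd. For nonzero `a ∈ GF(Q)` and `E = G(a)² - 4·a·F(a)^{q+1} ∈ GF(p^d)`: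
`P_a(X) = X^{q+1} + X + a` has no zeros in `GF(Q)` iff `E` is not a square in `GF(p^d)`,
i.e. `E^{(p^d-1)/2} ∉ {0, 1}`.  Here `F(a) = A_m(a)`,
`G(a) = -A_{m+1}(a) - a·A_{m-1}(a)^q`, `q = p^k`, `Q = p^n`, `d = gcd(n,k)`, `m = n/d`. -/
theorem statement_16 (p k n d m q Q : ℕ) [Fact p.Prime] (hp : Odd p) (hk : 0 < k) (hn : 0 < n)
    (hd : d = Nat.gcd n k) (hm : m = n / d) (hq : q = p ^ k) (hQ : Q = p ^ n)
    (a : Kbar p) (haQ : a ^ Q = a) (ha0 : a ≠ 0)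
    (Fa Ga E : Kbar p)
    (hFa : Fa = (A q (Kbar p) m).eval a)
    (hGa : Ga = -(A q (Kbar p) (m + 1)).eval a - a * ((A q (Kbar p) (m - 1)).eval a) ^ q)
    (hE : E = Ga ^ 2 - 4 * a * Fa ^ (q + 1)) :
    {x : Kbar p | x ^ Q = x ∧ x ^ (q + 1) + x + a = 0} = ∅
      ↔ E ^ ((p ^ d - 1) / 2) ≠ 0 ∧ E ^ ((p ^ d - 1) / 2) ≠ 1 := by
  have hpp : p.Prime := Fact.out
  have h2 : (2 : Kbar p) ≠ 0 := by
    have : NeZero (2 : Kbar p) := ⟨Ring.two_ne_zero (by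
      rw [ringChar.eq (Kbar p) p]
      rintro rfl
      exact absurd hp (by decide))⟩
    exact two_ne_zero
  have hd0 : 0 < d := hd ▸ Nat.gcd_pos_of_pos_left k hn
  have hm0 : 0 < m := by
    rw [hm, hd]
    exact Nat.div_pos (Nat.gcd_le_left k hn) (Nat.gcd_pos_of_pos_left k hn)
  obtain ⟨r, rfl⟩ := Nat.exists_eq_add_of_lt hm0
  rw [zero_add] at *
  have hodd : Odd (p ^ d) := hp.pow
  have hone : 1 < p ^ d := Nat.one_lt_pow hd0.ne' hpp.one_lt
  obtain ⟨t, ht⟩ := hodd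
  have ht' : (p ^ d - 1) / 2 = t := by lia
  have ht0 : t ≠ 0 := by lia
  have hdvd : n ∣ k * (r + 1) := by
    obtain ⟨c, hc⟩ := Nat.gcd_dvd_right n k
    refine ⟨c, ?_⟩
    have : n = d * (r + 1) := by rw [hm, hd, Nat.mul_div_cancel' (Nat.gcd_dvd_left n k)]
    rw [this]
    nth_rw 1 [hc, ← hd]
    ring
  have hfix : ∀ z : Kbar p, z ^ p ^ n = z → (iterateFrobenius (Kbar p) p k)^[r + 1] z = z := by
    intro z hz
    rw [iterateFrobenius_iterate_apply]
    exact pow_pow_eq_of_dvd hz hdvd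
  subst hq hQ
  have ha' := hfix a haQ
  rw [eval_A_eq_twistedSeq] at hFa hGa
  rw [eval_A_eq_twistedSeq, Nat.add_sub_cancel, ← iterateFrobenius_def] at hGa
  have hE' : E = Ga ^ 2 - 4 * a * (Fa * iterateFrobenius (Kbar p) p k Fa) := by
    rw [hE, iterateFrobenius_def, pow_succ' Fa]
  have hroot : ∀ x : Kbar p, x ^ (p ^ k + 1) + x + a = 0 ↔
      x * iterateFrobenius (Kbar p) p k x + x + a = 0 := fun x ↦ by
    rw [iterateFrobenius_def, pow_succ']
  have hinv := map_twistedSeq (iterateFrobenius_comm_apply (K := Kbar p) n k) haQ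
  have hFn : iterateFrobenius (Kbar p) p n Fa = Fa := by rw [hFa, hinv]
  have hGn : iterateFrobenius (Kbar p) p n Ga = Ga := by
    rw [hGa, map_sub, map_neg, map_mul, iterateFrobenius_comm_apply n k, hinv, hinv]
    congr 2
  rw [ht', ← not_or, ← Set.not_nonempty_iff_eq_empty, not_iff_not]
  constructor
  · rintro ⟨x, hxn, hx⟩
    rw [hroot] at hx
    obtain ⟨hyk, hyE⟩ := map_eq_self_and_sq_eq_of_root ha' ha0 hx (hfix x hxn)
    rw [← hFa, ← hGa] at hyk hyE
    rw [← hE'] at hyE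
    have hyn : iterateFrobenius (Kbar p) p n (2 * Fa * x + Ga) = 2 * Fa * x + Ga := by
      rw [map_add, map_mul, map_mul, hFn, hGn, map_ofNat, iterateFrobenius_def, hxn]
    generalize 2 * Fa * x + Ga = y at *
    have hyd := pow_pow_gcd_eq_self hyn hyk
    rw [← hd, ht, pow_succ, pow_mul, hyE] at hyd
    by_cases hy0 : y = 0
    · left
      rw [← hyE, hy0]
      simp [ht0]
    · right
      exact mul_right_cancel₀ hy0 (by rw [hyd, one_mul])
  · intro h
    by_cases hF : Fa = 0
    · obtain ⟨x, hxn, hx⟩ := exists_root_of_twistedSeq_eq_zero hn (by rw [hm, hd]) haQ ha0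
        (hFa ▸ hF)
      exact ⟨x, hxn, (hroot x).2 hx⟩
    · obtain ⟨y, hy⟩ := IsAlgClosed.exists_pow_nat_eq E two_pos
      have hyd : y ^ p ^ d = y := by
        rw [ht, pow_succ, pow_mul, hy]
        rcases h with h | h
        · rw [h, zero_mul, eq_comm, ← sq_eq_zero_iff, hy]
          exact pow_eq_zero_iff ht0 |>.1 h
        · rw [h, one_mul]
      have hyk := pow_pow_eq_of_dvd hyd (hd ▸ Nat.gcd_dvd_right n k)
      have hyn := pow_pow_eq_of_dvd hyd (hd ▸ Nat.gcd_dvd_left n k)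
      have hx : 2 * Fa * ((y - Ga) / (2 * Fa)) = y - Ga :=
        mul_div_cancel₀ _ (mul_ne_zero h2 hF)
      refine ⟨(y - Ga) / (2 * Fa), ?_, ?_⟩
      · rw [← iterateFrobenius_def, map_div₀, map_sub, map_mul, hFn, hGn, map_ofNat,
          iterateFrobenius_def, hyn]
      · rw [hroot]
        rw [hE'] at hy
        rw [hFa] at hF hx hy ⊢
        rw [hGa] at hx hy ⊢
        exact root_of_map_eq_self_sq_eq ha' h2 hF hyk hy hx
end
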